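/- Incremental small gain theorem: let H be a real Hilbert space, γ, λ ≥ 0 with γ·λ < 1, and let H₁, H₂ : H → H satisfy ‖H₁(a) − H₁(b)‖ ≤ γ‖a − b‖ and ‖H₂(a) − H₂(b)‖ ≤ λ‖a − b‖ for all a, b ∈ H. Consider the negative feedback interconnection: pairs (u, y) such that y = H₁(u − H₂(y)). Then for any two such pairs (u₁, y₁) and (u₂, y₂), ‖y₁ − y₂‖ ≤ (γ/(1 − γλ))·‖u₁ − u₂‖; that is, the closed loop from u to y has incremental gain bound γ/(1 − γλ). -/

import Mathlib

/-- incremental small gain theorem: if `H₁` is `γ`-Lipschitz, `H₂` is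
`λ`-Lipschitz and `γλ < 1`, then the negative feedback loop `y = H₁(u − H₂(y))` has
incremental gain bound `γ/(1 − γλ)` from `u` to `y`. -/
theorem incremental_small_gain
    {H : Type*} [NormedAddCommGroup H] [InnerProductSpace ℝ H] [CompleteSpace H]
    (γ lam : ℝ) (hγ : 0 ≤ γ) (hlam : 0 ≤ lam) (hsg : γ * lam < 1)
    (H₁ H₂ : H → H)
    (h₁ : ∀ a b : H, ‖H₁ a - H₁ b‖ ≤ γ * ‖a - b‖)
    (h₂ : ∀ a b : H, ‖H₂ a - H₂ b‖ ≤ lam * ‖a - b‖)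
    (u₁ y₁ u₂ y₂ : H)
    (hfb₁ : y₁ = H₁ (u₁ - H₂ y₁)) (hfb₂ : y₂ = H₁ (u₂ - H₂ y₂)) :
    ‖y₁ - y₂‖ ≤ (γ / (1 - γ * lam)) * ‖u₁ - u₂‖ := by
  have loop : ‖y₁ - y₂‖ ≤ γ * (‖u₁ - u₂‖ + lam * ‖y₁ - y₂‖) := by
    calc ‖y₁ - y₂‖ = ‖H₁ (u₁ - H₂ y₁) - H₁ (u₂ - H₂ y₂)‖ := by rw [← hfb₁, ← hfb₂]
      _ ≤ γ * ‖(u₁ - H₂ y₁) - (u₂ - H₂ y₂)‖ := h₁ _ _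
      _ = γ * ‖(u₁ - u₂) - (H₂ y₁ - H₂ y₂)‖ := by rw [sub_sub_sub_comm]
      _ ≤ γ * (‖u₁ - u₂‖ + ‖H₂ y₁ - H₂ y₂‖) := by gcongr; exact norm_sub_le _ _
      _ ≤ γ * (‖u₁ - u₂‖ + lam * ‖y₁ - y₂‖) := by gcongr; exact h₂ _ _
  rw [div_mul_eq_mul_div, le_div_iff₀ (sub_pos.mpr hsg)]
  linarith
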